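/- Let d ≥ 2 and let A_1, …, A_N be d×d complex matrices with ∑_{k=1}^N A_k* A_k = I. Then there exists an N×N unitary matrix V such that the matrices B_i = ∑_{j=1}^N V_{ij} A_j satisfy: (i) ∑_{k=1}^N B_k* B_k = I; (ii) ∑_{k=1}^N B_k X B_k* = ∑_{k=1}^N A_k X A_k* for every d×d complex matrix X; and (iii) for every k, the vectors B_k e_1 and B_k e_2 are orthogonal, i.e. ⟨B_k e_2, B_k e_1⟩ = 0 (equivalently, the first and second columns of every B_k are orthogonal). -/

import Mathlib

open Matrix

/-- The matrix of the rotation by the angle `t`, with phase `w`, in the plane spanned by the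
basis vectors `i` and `j`. -/
noncomputable def planeRotation {n : Type*} [DecidableEq n] (i j : n) (w : ℂ) (t : ℝ) :
    Matrix n n ℂ := fun k =>
  if k = i then Pi.single i (Real.cos t : ℂ) + Pi.single j (Real.sin t * w)
  else if k = j then Pi.single i (-(Real.sin t * star w)) + Pi.single j (Real.cos t : ℂ)
  else Pi.single k 1

theorem Matrix.IsHermitian.ofReal_re_apply_self {n : Type*} {M : Matrix n n ℂ} (hM : M.IsHermitian)
    (k : n) : ((M k k).re : ℂ) = M k k :=
  Complex.conj_eq_iff_re.mp (hM.apply k k)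

theorem exists_unit_re_mul_eq_zero (z : ℂ) : ∃ w : ℂ, w * star w = 1 ∧ (w * z).re = 0 := by
  obtain rfl | hz := eq_or_ne z 0
  · exact ⟨1, by simp⟩
  · have hn : (‖z‖ : ℂ) ≠ 0 := by simpa using hz
    refine ⟨Complex.I * star z / ‖z‖, ?_, ?_⟩
    · have := Complex.conj_mul' z
      simp only [star_div₀, star_mul', RCLike.star_def, Complex.conj_I,
        Complex.conj_ofReal, Complex.conj_conj]
      field_simp
      linear_combination (-(starRingEnd ℂ z * z)) * Complex.I_sq + this
    · have h : Complex.I * star z / ‖z‖ * z = ((‖z‖ : ℝ) : ℂ) * Complex.I := by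
        have := Complex.conj_mul' z
        rw [RCLike.star_def]
        field_simp
        linear_combination this
      rw [h, Complex.re_ofReal_mul, Complex.I_re, mul_zero]

theorem mul_mul_conjTranspose_apply_self {n : Type*} [Fintype n] (U M : Matrix n n ℂ)
    (k : n) : (U * M * Uᴴ) k k = U k ⬝ᵥ M *ᵥ star (U k) := by
  rw [dotProduct_mulVec]
  rfl

section

variable {n : Type*} [Fintype n] [DecidableEq n]

theorem planeRotation_mem_unitaryGroup {i j : n} (hij : i ≠ j) {w : ℂ} (hw : w * star w = 1)
    (t : ℝ) : planeRotation i j w t ∈ unitaryGroup n ℂ := by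
  have hcs : (Real.cos t : ℂ) ^ 2 + (Real.sin t : ℂ) ^ 2 = 1 := by
    exact_mod_cast Real.cos_sq_add_sin_sq t
  rw [mem_unitaryGroup_iff]
  ext k l
  change planeRotation i j w t k ⬝ᵥ star (planeRotation i j w t l) = _
  simp only [RCLike.star_def] at hw
  unfold planeRotation
  by_cases hki : k = i <;> by_cases hkj : k = j <;> by_cases hli : l = i <;>
    by_cases hlj : l = j <;>
    simp_all [dotProduct_add, Matrix.one_apply, Pi.single_apply, eq_comm,
      -Complex.ofReal_cos, -Complex.ofReal_sin]
  all_goals grind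

theorem dotProduct_mulVec_star_single_add_single (M : Matrix n n ℂ) (i j : n) (a b : ℂ) :
    (Pi.single i a + Pi.single j b) ⬝ᵥ M *ᵥ star (Pi.single i a + Pi.single j b) =
      a * star a * M i i + a * star b * M i j + b * star a * M j i + b * star b * M j j := by
  simp only [star_add, mulVec_add, add_dotProduct, dotProduct_add, Pi.star_single, mulVec_single,
    single_dotProduct]
  simp
  ring

theorem planeRotation_conj_apply_left (M : Matrix n n ℂ) (hM : M.IsHermitian) (i j : n) {w : ℂ}
    (hw : w * star w = 1) (t : ℝ) :
    (planeRotation i j w t * M * (planeRotation i j w t)ᴴ) i i =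
      ((Real.cos t ^ 2 * (M i i).re + Real.sin t ^ 2 * (M j j).re +
        2 * Real.cos t * Real.sin t * (w * M j i).re : ℝ) : ℂ) := by
  have hre : (2 * (w * M j i).re : ℂ) = w * M j i + star w * M i j := by
    rw [← hM.apply i j, ← star_mul', RCLike.star_def, Complex.add_conj]
    push_cast; rfl
  rw [mul_mul_conjTranspose_apply_self, planeRotation, if_pos rfl,
    dotProduct_mulVec_star_single_add_single]
  push_cast [-Complex.ofReal_cos, -Complex.ofReal_sin]
  rw [hM.ofReal_re_apply_self, hM.ofReal_re_apply_self]
  simp only [star_mul', RCLike.star_def, Complex.conj_ofReal] at hw hre ⊢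
  linear_combination (Real.sin t : ℂ) ^ 2 * M j j * hw - (Real.cos t * Real.sin t : ℂ) * hre

theorem planeRotation_conj_apply_right (M : Matrix n n ℂ) (hM : M.IsHermitian) {i j : n}
    (hij : i ≠ j) {w : ℂ} (hw : w * star w = 1) (t : ℝ) :
    (planeRotation i j w t * M * (planeRotation i j w t)ᴴ) j j =
      ((Real.sin t ^ 2 * (M i i).re + Real.cos t ^ 2 * (M j j).re -
        2 * Real.cos t * Real.sin t * (w * M j i).re : ℝ) : ℂ) := by
  have hre : (2 * (w * M j i).re : ℂ) = w * M j i + star w * M i j := by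
    rw [← hM.apply i j, ← star_mul', RCLike.star_def, Complex.add_conj]
    push_cast; rfl
  rw [mul_mul_conjTranspose_apply_self, planeRotation, if_neg hij.symm, if_pos rfl,
    dotProduct_mulVec_star_single_add_single]
  push_cast [-Complex.ofReal_cos, -Complex.ofReal_sin]
  rw [hM.ofReal_re_apply_self, hM.ofReal_re_apply_self]
  simp only [star_mul', star_neg, RCLike.star_def, Complex.conj_ofReal,
    Complex.conj_conj] at hw hre ⊢
  linear_combination (Real.sin t : ℂ) ^ 2 * M i i * hw + (Real.cos t * Real.sin t : ℂ) * hre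

theorem planeRotation_conj_apply_of_ne (M : Matrix n n ℂ) {i j k : n} (hki : k ≠ i) (hkj : k ≠ j)
    (w : ℂ) (t : ℝ) :
    (planeRotation i j w t * M * (planeRotation i j w t)ᴴ) k k = M k k := by
  rw [mul_mul_conjTranspose_apply_self, planeRotation, if_neg hki, if_neg hkj]
  simp

theorem exists_planeRotation_conj_apply_left_eq_zero (M : Matrix n n ℂ) (hM : M.IsHermitian)
    (i j : n) {w : ℂ} (hw : w * star w = 1) (hi : 0 < (M i i).re) (hj : (M j j).re < 0) :
    ∃ t : ℝ, (planeRotation i j w t * M * (planeRotation i j w t)ᴴ) i i = 0 := by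
  let f : ℝ → ℝ := fun t => Real.cos t ^ 2 * (M i i).re + Real.sin t ^ 2 * (M j j).re +
    2 * Real.cos t * Real.sin t * (w * M j i).re
  have hf : Continuous f := by fun_prop
  obtain ⟨t, ht⟩ := mem_range_of_exists_le_of_exists_ge (c := 0) hf
    ⟨Real.pi / 2, by simpa [f] using hj.le⟩ ⟨0, by simpa [f] using hi.le⟩
  exact ⟨t, by rw [planeRotation_conj_apply_left M hM i j hw]; exact_mod_cast ht⟩

theorem trace_unitary_conj {U : Matrix n n ℂ} (hU : U ∈ unitaryGroup n ℂ) (M : Matrix n n ℂ) :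
    (U * M * Uᴴ).trace = M.trace := by
  rw [trace_mul_comm, ← Matrix.mul_assoc, ← star_eq_conjTranspose, mem_unitaryGroup_iff'.mp hU,
    Matrix.one_mul]

theorem exists_unitary_conj_diag_eq_zero_of_isHermitian (P Q : Matrix n n ℂ)
    (hP : P.IsHermitian) (hQ : Q.IsHermitian) (hPd : ∀ k, P k k = 0) (hQt : Q.trace = 0) :
    ∃ U ∈ unitaryGroup n ℂ, (∀ k, (U * P * Uᴴ) k k = 0) ∧ ∀ k, (U * Q * Uᴴ) k k = 0 := by
  induction hm : (Finset.univ.filter fun k => Q k k ≠ 0).card using Nat.strong_induction_on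
    generalizing P Q with
  | _ m ih =>
  by_cases hQd : ∀ k, Q k k = 0
  · exact ⟨1, one_mem _, by simpa using hPd, by simpa using hQd⟩
  push Not at hQd
  obtain ⟨k₀, hk₀⟩ := hQd
  have hsum : ∑ k, (Q k k).re = 0 := by
    rw [← Complex.re_sum]; exact congrArg Complex.re hQt
  have hk₀' : (Q k₀ k₀).re ≠ 0 := fun h => hk₀ (by rw [← hQ.ofReal_re_apply_self, h]; simp)
  obtain ⟨i, -, hi⟩ := Finset.exists_pos_of_sum_zero_of_exists_nonzero _ hsum
    ⟨k₀, Finset.mem_univ _, hk₀'⟩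
  obtain ⟨j, -, hj⟩ := Finset.exists_pos_of_sum_zero_of_exists_nonzero
    (fun k => -(Q k k).re) (by simpa using hsum) ⟨k₀, Finset.mem_univ _, by simpa using hk₀'⟩
  rw [neg_pos] at hj
  have hij : i ≠ j := by rintro rfl; exact hi.not_gt hj
  obtain ⟨w, hw, hwP⟩ := exists_unit_re_mul_eq_zero (P j i)
  obtain ⟨t, ht⟩ := exists_planeRotation_conj_apply_left_eq_zero Q hQ i j hw hi hj
  set R := planeRotation i j w t with hR
  have hRU : R ∈ unitaryGroup n ℂ := planeRotation_mem_unitaryGroup hij hw t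
  have hRP : ∀ k, (R * P * Rᴴ) k k = 0 := by
    intro k
    obtain rfl | hki := eq_or_ne k i
    · rw [hR, planeRotation_conj_apply_left P hP k j hw]; simp [hPd, hwP]
    obtain rfl | hkj := eq_or_ne k j
    · rw [hR, planeRotation_conj_apply_right P hP hij hw]; simp [hPd, hwP]
    · rw [hR, planeRotation_conj_apply_of_ne P hki hkj, hPd]
  have hcard : (Finset.univ.filter fun k => (R * Q * Rᴴ) k k ≠ 0).card < m := by
    rw [← hm]
    refine Finset.card_lt_card ((Finset.ssubset_iff_of_subset fun k hk => ?_).mpr ⟨i, ?_, ?_⟩)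
    · simp only [Finset.mem_filter_univ] at hk ⊢
      have hki : k ≠ i := by rintro rfl; exact hk ht
      obtain rfl | hkj := eq_or_ne k j
      · intro h; simp [h] at hj
      · rwa [hR, planeRotation_conj_apply_of_ne Q hki hkj] at hk
    · rw [Finset.mem_filter_univ]; intro h; simp [h] at hi
    · simp [ht]
  obtain ⟨U, hU, hUP, hUQ⟩ := ih _ hcard (R * P * Rᴴ) (R * Q * Rᴴ)
    (isHermitian_mul_mul_conjTranspose R hP) (isHermitian_mul_mul_conjTranspose R hQ) hRP
    ((trace_unitary_conj hRU Q).trans hQt) rfl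
  refine ⟨U * R, mul_mem hU hRU, fun k => ?_, fun k => ?_⟩
  · simpa only [conjTranspose_mul, Matrix.mul_assoc] using hUP k
  · simpa only [conjTranspose_mul, Matrix.mul_assoc] using hUQ k

/-- A square complex matrix of trace zero is unitarily similar to one with zero diagonal. -/
theorem exists_unitary_conj_diag_eq_zero (M : Matrix n n ℂ) (hM : M.trace = 0) :
    ∃ U ∈ unitaryGroup n ℂ, ∀ k, (U * M * Uᴴ) k k = 0 := by
  have hMs : (Mᴴ).trace = 0 := by rw [trace_conjTranspose, hM, star_zero]
  let P : Matrix n n ℂ := M + Mᴴ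
  let Q : Matrix n n ℂ := Complex.I • (M - Mᴴ)
  have hP : P.IsHermitian := isHermitian_add_transpose_self M
  have hQ : Q.IsHermitian := by
    simp [Q, IsHermitian, conjTranspose_smul, ← smul_neg]
  obtain ⟨U, hU, -, hUP⟩ := exists_unitary_conj_diag_eq_zero_of_isHermitian 0 P
    isHermitian_zero hP (by simp) (by simp [P, trace_add, hM, hMs])
  obtain ⟨W, hW, hWP, hWQ⟩ := exists_unitary_conj_diag_eq_zero_of_isHermitian
    (U * P * Uᴴ) (U * Q * Uᴴ) (isHermitian_mul_mul_conjTranspose U hP)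
    (isHermitian_mul_mul_conjTranspose U hQ) hUP
    (by simp [trace_unitary_conj hU, Q, trace_sub, hM, hMs])
  refine ⟨W * U, mul_mem hW hU, fun k => ?_⟩
  have hMPQ : M = (1 / 2 : ℂ) • (P - Complex.I • Q) := by
    ext a b
    simp [P, Q, smul_smul]
    ring
  have h : W * U * M * (W * U)ᴴ =
      (1 / 2 : ℂ) • (W * (U * P * Uᴴ) * Wᴴ - Complex.I • (W * (U * Q * Uᴴ) * Wᴴ)) := by
    conv_lhs => rw [hMPQ]
    simp only [conjTranspose_mul, Matrix.mul_smul, Matrix.smul_mul, Matrix.mul_sub,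
      Matrix.sub_mul, Matrix.mul_assoc]
  rw [h]
  simp [hWP, hWQ]

theorem sum_star_mul_smul_of_mem_unitaryGroup {E : Type*} [AddCommGroup E] [Module ℂ E]
    {V : Matrix n n ℂ} (hV : V ∈ unitaryGroup n ℂ) (G : n → n → E) :
    ∑ k, ∑ j, ∑ l, (star (V k j) * V k l) • G j l = ∑ j, G j j := by
  have h (j l : n) : ∑ k, star (V k j) * V k l = (1 : Matrix n n ℂ) j l :=
    congrFun₂ (mem_unitaryGroup_iff'.mp hV) j l
  rw [Finset.sum_comm]
  refine Finset.sum_congr rfl fun j _ => ?_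
  rw [Finset.sum_comm]
  simp only [← Finset.sum_smul, h]
  simp [Matrix.one_apply]

end

/-- Given `d ≥ 2` and Kraus operators `A 1, …, A N` with
`∑ k, (A k)ᴴ * A k = 1`, there exists a unitary `N × N` matrix `V` such that
the matrices `B i = ∑ j, V i j • A j` satisfy: (i) `∑ k, (B k)ᴴ * B k = 1`;
(ii) `∑ k, B k * X * (B k)ᴴ = ∑ k, A k * X * (A k)ᴴ` for every `d × d`
complex `X`; and (iii) for every `k`, `⟨(B k) e₂, (B k) e₁⟩ = 0`, i.e. the
first and second columns of each `B k` are orthogonal. Here `e₁, e₂` are the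
first two standard basis vectors of `ℂ^d` and `⟨x, y⟩ = star x ⬝ᵥ y`. -/
theorem exists_kraus_representation_with_orthogonal_columns
    (d N : ℕ) (hd : 2 ≤ d)
    (A : Fin N → Matrix (Fin d) (Fin d) ℂ)
    (hA : ∑ k, (A k)ᴴ * A k = 1) :
    ∃ V : Matrix (Fin N) (Fin N) ℂ,
      (V * Vᴴ = 1 ∧ Vᴴ * V = 1) ∧
        ∀ B : Fin N → Matrix (Fin d) (Fin d) ℂ,
          (∀ i, B i = ∑ j, V i j • A j) →
            (∑ k, (B k)ᴴ * B k = 1) ∧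
            (∀ X : Matrix (Fin d) (Fin d) ℂ,
              ∑ k, B k * X * (B k)ᴴ = ∑ k, A k * X * (A k)ᴴ) ∧
            (∀ k,
              star ((B k).mulVec (Pi.single (⟨1, by omega⟩ : Fin d) (1 : ℂ))) ⬝ᵥ
                ((B k).mulVec (Pi.single (⟨0, by omega⟩ : Fin d) (1 : ℂ))) = 0) := by
  set a : Fin d := ⟨0, by omega⟩
  set b : Fin d := ⟨1, by omega⟩
  let M : Matrix (Fin N) (Fin N) ℂ := of fun j l =>
    star ((A l).mulVec (Pi.single b 1)) ⬝ᵥ (A j).mulVec (Pi.single a 1)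
  have hM : M.trace = 0 := by
    have h : b ≠ a := by simp [a, b]
    have := congrFun₂ hA b a
    rw [Matrix.one_apply_ne h, Matrix.sum_apply] at this
    simpa [M, Matrix.trace, Matrix.mul_apply, dotProduct] using this
  obtain ⟨V, hV, hVM⟩ := exists_unitary_conj_diag_eq_zero M hM
  refine ⟨V, ⟨mem_unitaryGroup_iff.mp hV, mem_unitaryGroup_iff'.mp hV⟩, fun B hB => ⟨?_, ?_, ?_⟩⟩
  · rw [← hA, ← sum_star_mul_smul_of_mem_unitaryGroup hV fun j l => (A j)ᴴ * A l]
    simp [hB, conjTranspose_sum, Finset.sum_mul_sum, smul_smul, mul_comm]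
  · intro X
    rw [← sum_star_mul_smul_of_mem_unitaryGroup hV fun j l => A l * X * (A j)ᴴ]
    refine Finset.sum_congr rfl fun k _ => ?_
    simp [hB, conjTranspose_sum, Finset.sum_mul, Finset.mul_sum, Finset.smul_sum, smul_smul,
      mul_comm]
  · intro k
    rw [← hVM k]
    simp only [hB, sum_mulVec, smul_mulVec, star_sum, star_smul, sum_dotProduct, dotProduct_sum,
      smul_dotProduct, dotProduct_smul, Finset.mul_sum, Matrix.mul_apply, Finset.sum_mul,
      conjTranspose_apply, M, of_apply, smul_eq_mul]
    rw [Finset.sum_comm]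
    refine Finset.sum_congr rfl fun l _ => Finset.sum_congr rfl fun j _ => ?_
    ring
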